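/- Let G be a finite group, c ∈ G an element of order m ≥ 1, H = ⟨c⟩, ζ a primitive m-th root of unity in ℂ, and ω : H → ℂ* the one-dimensional character with ω(c) = ζ. Let r be a positive integer and write r = l + s·m with integers s ≥ 0 and 0 ≤ l < m. Let V be a finite-dimensional complex irreducible representation of G, given by ρ : G → GL(V), with character χ_V. Then the multiplicity of V in the induced class function Ind_H^G(∑_{k=1}^{r} ω^{-k}) (which is the equivariant degree of the G-invariant divisor r·D_b(P) when H is the stabilizer of a point P of a compact Riemann surface with G-action and ω is the ramification character at P) is given by ⟨Ind_H^G(∑_{k=1}^{r} ω^{-k}), χ_V⟩ = s·dim_ℂ(V) + ε·(dim_ℂ(V) − ∑_{k=0}^{m-(l+1)} N_k^V), where ε = 0 if l = 0 and ε = 1 if l ≠ 0, and N_k^V is the dimension of the ζ^k-eigenspace of ρ(c). -/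

import Mathlib

open scoped BigOperators

open Classical in
/-- The induced class function `Ind_H^G ψ` of a function `ψ : H → ℂ`, given by
`(Ind_H^G ψ)(g) = (1/|H|) · ∑_{x ∈ G, x⁻¹gx ∈ H} ψ(x⁻¹gx)`. -/
noncomputable def indClassFun {G : Type*} [Group G] [Fintype G] (H : Subgroup G)
    (ψ : H → ℂ) : G → ℂ :=
  fun g => (Nat.card H : ℂ)⁻¹ *
    ∑ x : G, if h : x⁻¹ * g * x ∈ H then ψ ⟨x⁻¹ * g * x, h⟩ else 0

/-- The inner product of two class functions `φ, ψ : G → ℂ`: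
`⟨φ, ψ⟩ = (1/|G|) · ∑_{g ∈ G} φ(g) · conj(ψ(g))`. -/
noncomputable def innerCF {G : Type*} [Group G] [Fintype G] (φ ψ : G → ℂ) : ℂ :=
  (Fintype.card G : ℂ)⁻¹ * ∑ g : G, φ g * (starRingEnd ℂ) (ψ g)

lemma aux_geom {m : ℕ} {ζ : ℂ} (hζ : IsPrimitiveRoot ζ m) (a : ℤ) :
    ∑ j ∈ Finset.range m, (ζ ^ a) ^ j = if (m : ℤ) ∣ a then (m : ℂ) else 0 := by
  split_ifs with h
  · rw [(hζ.zpow_eq_one_iff_dvd a).2 h]; simp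
  · have h1 : ζ ^ a ≠ 1 := fun h' => h ((hζ.zpow_eq_one_iff_dvd a).1 h')
    have h2 : (ζ ^ a) ^ m = 1 := by
      rw [← zpow_natCast, ← zpow_mul, mul_comm, zpow_mul, zpow_natCast, hζ.pow_eq_one, one_zpow]
    have h3 := mul_geom_sum (ζ ^ a) m
    rw [h2, sub_self] at h3
    exact (mul_eq_zero.1 h3).resolve_left (sub_ne_zero.2 h1)

/-- The projector onto the `ζ ^ k`-eigenspace. -/
noncomputable def auxProj {V : Type*} [AddCommGroup V] [Module ℂ V] (A : Module.End ℂ V)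
    (m : ℕ) (ζ : ℂ) (k : ℕ) : Module.End ℂ V :=
  (m : ℂ)⁻¹ • ∑ j ∈ Finset.range m, (ζ ^ (-(k : ℤ))) ^ j • A ^ j

section
variable {V : Type*} [AddCommGroup V] [Module ℂ V]

lemma aux_mul_proj {A : Module.End ℂ V} {m : ℕ} (hm : 1 ≤ m) (hA : A ^ m = 1) {ζ : ℂ}
    (hζ : IsPrimitiveRoot ζ m) (k : ℕ) : A * auxProj A m ζ k = ζ ^ k • auxProj A m ζ k := by
  have hζ0 : ζ ≠ 0 := hζ.ne_zero (by omega)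
  set x : ℂ := ζ ^ (-(k : ℤ)) with hx
  have hxk : ζ ^ k * x = 1 := by
    rw [hx, zpow_neg, zpow_natCast]; exact mul_inv_cancel₀ (pow_ne_zero _ hζ0)
  have hxm : x ^ m = 1 := by
    rw [hx, ← zpow_natCast, ← zpow_mul, mul_comm, zpow_mul, zpow_natCast, hζ.pow_eq_one, one_zpow]
  have h1 : ∑ j ∈ Finset.range m, x ^ (j+1) • A ^ (j+1) = ∑ j ∈ Finset.range m, x ^ j • A ^ j := by
    have e1 := Finset.sum_range_succ (fun j => x ^ j • A ^ j) m
    have e2 := Finset.sum_range_succ' (fun j => x ^ j • A ^ j) m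
    rw [e1] at e2
    simp only [hxm, hA, pow_zero] at e2
    exact (add_right_cancel e2).symm
  unfold auxProj
  rw [mul_smul_comm, smul_comm]
  congr 1
  rw [← hx]
  have : ∀ j, A * x ^ j • A ^ j = ζ ^ k • x ^ (j+1) • A ^ (j+1) := by
    intro j
    rw [mul_smul_comm, ← pow_succ', smul_smul, pow_succ' x, ← mul_assoc, hxk, one_mul]
  conv_rhs => rw [← h1, Finset.smul_sum]
  rw [Finset.mul_sum]
  exact Finset.sum_congr rfl fun j _ => this j

lemma aux_pow_proj {A : Module.End ℂ V} {m : ℕ} (hm : 1 ≤ m) (hA : A ^ m = 1) {ζ : ℂ}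
    (hζ : IsPrimitiveRoot ζ m) (k j : ℕ) :
    A ^ j * auxProj A m ζ k = (ζ ^ k) ^ j • auxProj A m ζ k := by
  induction j with
  | zero => simp
  | succ n ih => rw [pow_succ, mul_assoc, aux_mul_proj hm hA hζ, mul_smul_comm, ih, smul_smul,
      pow_succ']

lemma aux_isProj {A : Module.End ℂ V} {m : ℕ} (hm : 1 ≤ m) (hA : A ^ m = 1) {ζ : ℂ}
    (hζ : IsPrimitiveRoot ζ m) (k : ℕ) :
    LinearMap.IsProj (Module.End.eigenspace A (ζ ^ k)) (auxProj A m ζ k) := by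
  have hζ0 : ζ ≠ 0 := hζ.ne_zero (by omega)
  have hm0 : (m : ℂ) ≠ 0 := by exact_mod_cast (by omega : m ≠ 0)
  constructor
  · intro v
    rw [Module.End.mem_eigenspace_iff]
    exact LinearMap.congr_fun (aux_mul_proj hm hA hζ k) v
  · intro v hv
    rw [Module.End.mem_eigenspace_iff] at hv
    have hp : ∀ j : ℕ, (A ^ j) v = (ζ ^ k) ^ j • v := by
      intro j
      induction j with
      | zero => simp
      | succ n ih => rw [pow_succ, Module.End.mul_apply, hv, map_smul, ih, smul_smul, pow_succ']
    have hx : ∀ j : ℕ, (ζ ^ (-(k : ℤ))) ^ j * (ζ ^ k) ^ j = 1 := by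
      intro j
      rw [← mul_pow, zpow_neg, zpow_natCast, inv_mul_cancel₀ (pow_ne_zero _ hζ0), one_pow]
    simp only [auxProj, LinearMap.smul_apply, LinearMap.sum_apply, hp, smul_smul, hx, one_smul]
    rw [Finset.sum_const, Finset.card_range, ← Nat.cast_smul_eq_nsmul ℂ, smul_smul,
      inv_mul_cancel₀ hm0, one_smul]

lemma aux_sum_proj {A : Module.End ℂ V} {m : ℕ} (hm : 1 ≤ m) {ζ : ℂ}
    (hζ : IsPrimitiveRoot ζ m) :
    ∑ k ∈ Finset.range m, auxProj A m ζ k = 1 := by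
  have hm0 : (m : ℂ) ≠ 0 := by exact_mod_cast (by omega : m ≠ 0)
  unfold auxProj
  rw [← Finset.smul_sum, Finset.sum_comm]
  have h : ∀ j ∈ Finset.range m, ∑ k ∈ Finset.range m, (ζ ^ (-(k : ℤ))) ^ j • A ^ j
      = if j = 0 then (m : ℂ) • (1 : Module.End ℂ V) else 0 := by
    intro j hj
    rw [← Finset.sum_smul]
    have e : ∀ k : ℕ, (ζ ^ (-(k : ℤ))) ^ j = (ζ ^ (-(j : ℤ))) ^ k := by
      intro k
      rw [← zpow_natCast, ← zpow_natCast, ← zpow_mul, ← zpow_mul]; congr 1; ring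
    rw [Finset.sum_congr rfl fun k _ => e k, aux_geom hζ]
    rw [Finset.mem_range] at hj
    by_cases h0 : j = 0
    · subst h0; simp
    · rw [if_neg h0, if_neg, zero_smul]
      rw [dvd_neg, Int.natCast_dvd_natCast]
      exact fun hd => h0 (Nat.eq_zero_of_dvd_of_lt hd hj)
  rw [Finset.sum_congr rfl h, Finset.sum_ite_eq' ]
  rw [if_pos (Finset.mem_range.2 (by omega)), smul_smul, inv_mul_cancel₀ hm0, one_smul]

lemma aux_trace [FiniteDimensional ℂ V] {A : Module.End ℂ V} {m : ℕ} (hm : 1 ≤ m)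
    (hA : A ^ m = 1) {ζ : ℂ} (hζ : IsPrimitiveRoot ζ m) (j : ℕ) :
    LinearMap.trace ℂ V (A ^ j) = ∑ k ∈ Finset.range m,
      (ζ ^ k) ^ j * (Module.finrank ℂ (Module.End.eigenspace A (ζ ^ k)) : ℂ) := by
  conv_lhs => rw [← mul_one (A ^ j), ← aux_sum_proj (A := A) hm hζ, Finset.mul_sum, map_sum]
  refine Finset.sum_congr rfl fun k _ => ?_
  rw [aux_pow_proj hm hA hζ, map_smul, (aux_isProj hm hA hζ k).trace, smul_eq_mul]
end

lemma aux_frob {G : Type*} [Group G] [Fintype G] (H : Subgroup G) [Fintype H] (ψ : H → ℂ)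
    (χ : G → ℂ) (hχ : ∀ x g, χ (x * g * x⁻¹) = χ g) :
    innerCF (indClassFun H ψ) χ =
      (Nat.card H : ℂ)⁻¹ * ∑ h : H, ψ h * (starRingEnd ℂ) (χ h) := by
  classical
  have hG : (Fintype.card G : ℂ) ≠ 0 := by exact_mod_cast Fintype.card_ne_zero
  unfold innerCF indClassFun
  have h1 : ∀ x : G, ∑ g : G, (if h : x⁻¹ * g * x ∈ H then ψ ⟨x⁻¹ * g * x, h⟩ else 0) *
      (starRingEnd ℂ) (χ g) = ∑ h : H, ψ h * (starRingEnd ℂ) (χ h) := by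
    intro x
    have e : ∑ g : G, (if h : x⁻¹ * g * x ∈ H then ψ ⟨x⁻¹ * g * x, h⟩ else 0) *
      (starRingEnd ℂ) (χ g) = ∑ g : G, (if h : g ∈ H then ψ ⟨g, h⟩ else 0) *
      (starRingEnd ℂ) (χ g) := by
      refine Fintype.sum_equiv (MulAut.conj x⁻¹).toEquiv _ _ fun g => ?_
      have : (MulAut.conj x⁻¹).toEquiv g = x⁻¹ * g * x := by simp
      rw [this]
      have h2 := hχ x⁻¹ g
      rw [inv_inv] at h2
      rw [h2]
    rw [e]
    have h3 : ∑ g : G, (if h : g ∈ H then ψ ⟨g, h⟩ else 0) * (starRingEnd ℂ) (χ g)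
        = ∑ g ∈ Finset.univ.filter (· ∈ H), (if h : g ∈ H then ψ ⟨g, h⟩ else 0) *
          (starRingEnd ℂ) (χ g) := by
      rw [Finset.sum_filter]
      refine Finset.sum_congr rfl fun g _ => ?_
      by_cases h : g ∈ H <;> simp [h]
    rw [h3, Finset.sum_subtype (p := (· ∈ H)) _ (by simp)]
    refine Finset.sum_congr (by congr!) fun h _ => ?_
    simp
  simp only [mul_assoc, Finset.sum_mul, ← Finset.mul_sum]
  rw [Finset.sum_comm]
  simp only [← mul_assoc] at h1 ⊢
  rw [Finset.sum_congr rfl fun x _ => h1 x, Finset.sum_const, Finset.card_univ, nsmul_eq_mul]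
  field_simp

lemma aux_zpowers_sum {G : Type*} [Group G] [Fintype G] (c : G)
    [Fintype (Subgroup.zpowers c)] (F : Subgroup.zpowers c → ℂ) :
    ∑ h, F h = ∑ j ∈ Finset.range (orderOf c), F (⟨c, Subgroup.mem_zpowers c⟩ ^ j) := by
  rw [← Fin.sum_univ_eq_sum_range (fun j => F (⟨c, Subgroup.mem_zpowers c⟩ ^ j))]
  symm
  refine Fintype.sum_equiv (finEquivZPowers (isOfFinOrder_of_finite c)) _ _ fun j => ?_
  congr 1

lemma aux_comb {m : ℕ} (hm : 1 ≤ m) (N : ℕ → ℂ) (f : ℕ → ℂ)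
    (hf : ∀ k, f k = ∑ i ∈ Finset.range m, if m ∣ k + i then N i else 0) (l s : ℕ) (hl : l < m) :
    ∑ k ∈ Finset.range (l + s * m), f (k + 1) =
      s * ∑ i ∈ Finset.range m, N i +
        (∑ i ∈ Finset.range m, N i - ∑ i ∈ Finset.range (m - l), N i) := by
  have hper : ∀ k, f (m + k) = f k := by
    intro k
    rw [hf, hf]
    refine Finset.sum_congr rfl fun i _ => ?_
    simp only [add_assoc, Nat.dvd_add_right (dvd_refl m)]
  have hval : ∀ k, k < m → f (k + 1) = N (m - 1 - k) := by
    intro k hk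
    rw [hf, Finset.sum_eq_single (m - 1 - k)]
    · rw [if_pos]; exact ⟨1, by omega⟩
    · intro i hi hne
      rw [Finset.mem_range] at hi
      rw [if_neg]
      rintro ⟨q, hq⟩
      have : q = 1 := by
        rcases q with _ | _ | q
        · omega
        · rfl
        · exfalso; nlinarith
      subst this; omega
    · intro h; exact absurd (Finset.mem_range.2 (by omega)) h
  have hpart : ∀ l, l ≤ m → ∑ k ∈ Finset.range l, f (k + 1) =
      ∑ i ∈ Finset.range m, N i - ∑ i ∈ Finset.range (m - l), N i := by
    intro l
    induction l with
    | zero => simp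
    | succ n ih =>
      intro h
      rw [Finset.sum_range_succ, ih (by omega), hval n (by omega)]
      have : m - n = (m - (n + 1)) + 1 := by omega
      rw [this, Finset.sum_range_succ]
      have : m - 1 - n = m - (n + 1) := by omega
      rw [this]; ring
  induction s with
  | zero => rw [zero_mul, add_zero, hpart l hl.le]; simp
  | succ s ih =>
    have : l + (s + 1) * m = m + (l + s * m) := by ring
    rw [this, Finset.sum_range_add, hpart m le_rfl]
    have : ∀ k, f (m + k + 1) = f (k + 1) := fun k => by rw [add_assoc, hper]
    simp only [this, ih]
    push_cast
    simp
    ring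

/-- Let `G` be a finite group, `c ∈ G` of order `m ≥ 1`, `H = ⟨c⟩`, `ζ` a primitive `m`-th
root of unity in `ℂ`, and `ω : H → ℂ*` the one-dimensional character with `ω(c) = ζ`.
Let `r > 0` be an integer, written `r = l + s·m` with `s ≥ 0` and `0 ≤ l < m`.
Let `(V, ρ)` be a finite-dimensional complex irreducible representation of `G` with
character `χ_V`.  Then the multiplicity of `V` in `Ind_H^G (∑_{k=1}^{r} ω^{-k})`
(the equivariant degree of the divisor `r·D_b(P)`) is
`⟨Ind_H^G (∑_{k=1}^{r} ω^{-k}), χ_V⟩ = s·dim_ℂ(V) + ε·(dim_ℂ(V) - ∑_{k=0}^{m-(l+1)} N_k^V)`,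
where `ε = 0` if `l = 0` and `ε = 1` if `l ≠ 0`, and `N_k^V` is the dimension of the
`ζ^k`-eigenspace of `ρ(c)`. -/
theorem multiplicity_in_equivariant_degree
    {G : Type*} [Group G] [Fintype G] (c : G) (m : ℕ) (hm : 1 ≤ m)
    (hc : orderOf c = m) (ζ : ℂ) (hζ : IsPrimitiveRoot ζ m)
    (ω : (Subgroup.zpowers c) →* ℂ)
    (hω : ω ⟨c, Subgroup.mem_zpowers c⟩ = ζ)
    (r l s : ℕ) (hr : 0 < r) (hls : r = l + s * m) (hl : l < m)
    (V : Type*) [AddCommGroup V] [Module ℂ V] [FiniteDimensional ℂ V]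
    (ρ : Representation ℂ G V)
    (hirr : IsSimpleModule (MonoidAlgebra ℂ G) ρ.asModule) :
    innerCF
        (indClassFun (Subgroup.zpowers c)
          (fun h => ∑ k ∈ Finset.Icc 1 r, (ω h) ^ (-(k : ℤ))))
        (fun g => LinearMap.trace ℂ V (ρ g)) =
      (s : ℂ) * (Module.finrank ℂ V : ℂ) +
        (if l = 0 then (0 : ℂ) else 1) *
          ((Module.finrank ℂ V : ℂ) -
            ∑ k ∈ Finset.range (m - (l + 1) + 1),
              (Module.finrank ℂ (Module.End.eigenspace (ρ c) (ζ ^ k)) : ℂ)) := by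
  have hc' : (ρ c) ^ m = 1 := by rw [← map_pow, ← hc, pow_orderOf_eq_one, map_one]
  have hm0 : (m : ℂ) ≠ 0 := by exact_mod_cast (by omega : m ≠ 0)
  have hζ0 : ζ ≠ 0 := hζ.ne_zero (by omega)
  have hconj : (starRingEnd ℂ) ζ = ζ⁻¹ :=
    (Complex.inv_eq_conj (hζ.norm'_eq_one (by omega))).symm
  let _ : Fintype (Subgroup.zpowers c) := Fintype.ofFinite _
  rw [aux_frob _ _ _ (fun x g => by
    rw [map_mul ρ, LinearMap.trace_mul_comm, ← map_mul ρ, ← mul_assoc, inv_mul_cancel,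
      one_mul])]
  rw [aux_zpowers_sum, Nat.card_zpowers, hc]
  set N : ℕ → ℂ := fun k => (Module.finrank ℂ (Module.End.eigenspace (ρ c) (ζ ^ k)) : ℂ) with hN
  have hdim : (Module.finrank ℂ V : ℂ) = ∑ i ∈ Finset.range m, N i := by
    have := aux_trace hm hc' hζ 0
    simpa using this
  have hterm : ∀ j : ℕ, (∑ k ∈ Finset.Icc 1 r,
      (ω (⟨c, Subgroup.mem_zpowers c⟩ ^ j)) ^ (-(k : ℤ))) *
      (starRingEnd ℂ) (LinearMap.trace ℂ V
        (ρ ((⟨c, Subgroup.mem_zpowers c⟩ ^ j : Subgroup.zpowers c) : G))) =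
      ∑ k ∈ Finset.range r, ∑ i ∈ Finset.range m,
        (ζ ^ (-((k + 1 + i : ℕ) : ℤ))) ^ j * N i := by
    intro j
    rw [map_pow, hω, Subgroup.coe_pow, map_pow, aux_trace hm hc' hζ, map_sum, Finset.sum_mul_sum]
    rw [Finset.range_eq_Ico r, Finset.sum_Ico_add' (fun k => ∑ i ∈ Finset.range m,
        (ζ ^ (-((k + i : ℕ) : ℤ))) ^ j * N i) 0 r 1]
    refine Finset.sum_congr (by ext; simp <;> omega) fun k _ => Finset.sum_congr rfl fun i _ => ?_
    simp only [map_mul, map_pow, hconj, map_natCast]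
    rw [← mul_assoc]
    congr 1
    simp only [zpow_neg, zpow_natCast, inv_pow, ← pow_mul, ← mul_inv, ← pow_add]
    congr 2
    ring
  rw [Finset.sum_congr rfl fun j _ => hterm j, Finset.sum_comm, Finset.mul_sum]
  set f : ℕ → ℂ := fun k => ∑ i ∈ Finset.range m, if m ∣ k + i then N i else 0 with hf
  have hfk : ∀ k : ℕ, (m : ℂ)⁻¹ * ∑ j ∈ Finset.range m, ∑ i ∈ Finset.range m,
        (ζ ^ (-((k + 1 + i : ℕ) : ℤ))) ^ j * N i = f (k + 1) := by
    intro k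
    rw [Finset.sum_comm, Finset.mul_sum]
    refine Finset.sum_congr rfl fun i _ => ?_
    rw [← Finset.sum_mul, aux_geom hζ]
    simp only [dvd_neg, Int.natCast_dvd_natCast]
    split_ifs
    · rw [← mul_assoc, inv_mul_cancel₀ hm0, one_mul]
    · simp
  rw [Finset.sum_congr rfl fun k _ => hfk k, hls, aux_comb hm N f (fun _ => rfl) l s hl, hdim]
  have hml : m - (l + 1) + 1 = m - l := by omega
  rw [hml]
  split_ifs with h0
  · subst h0; simp
  · rw [one_mul]
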